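/- arXiv:2212.03328 — 2 statements merged into one kernel-verified Lean document; each statement's English description precedes it below -/
import Mathlib

section
/- There is an absolute constant c > 0 such that for every n ≥ 2, any finite collection of hyperplanes in ℝ^n that dissects every edge of the n-cube graph Q_n must contain at least c · n^{2/3} / (log n)^{4/3} hyperplanes. Equivalently, H(n) ≥ c · n^{2/3} / (log n)^{4/3}, where H(n) denotes the minimum number of hyperplanes in ℝ^n needed to dissect all edges of Q_n. -/
/-- `u` is a vertex of the `n`-cube `{-1,1}^n`. -/
def isCubeVertex {n : ℕ} (u : Fin n → ℝ) : Prop := ∀ i, u i = 1 ∨ u i = -1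

/-- The vertex obtained from `u` by flipping the sign of the `k`-th coordinate. -/
def flipCoord {n : ℕ} (u : Fin n → ℝ) (k : Fin n) : Fin n → ℝ :=
  fun i => if i = k then -u i else u i

/-- The hyperplane `{x | ⟨v, x⟩ = t}` dissects the edge `(u, k)` of the `n`-cube:
it meets the segment between the two endpoints but contains neither endpoint. -/
def dissectsEdge {n : ℕ} (v : Fin n → ℝ) (t : ℝ) (u : Fin n → ℝ) (k : Fin n) : Prop :=
  (∃ y ∈ segment ℝ u (flipCoord u k), ∑ i, v i * y i = t) ∧
    (∑ i, v i * u i ≠ t) ∧ (∑ i, v i * flipCoord u k i ≠ t)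

namespace CubeSlice

/-- sign of a Boolean -/
noncomputable def sg (b : Bool) : ℝ := if b then 1 else -1

/-- flip of a coordinate -/
def fl {n : ℕ} (X : Fin n → Bool) (k : Fin n) : Fin n → Bool := Function.update X k (!X k)

/-- product weight with mean `x` -/
noncomputable def W {n : ℕ} (x : Fin n → ℝ) (X : Fin n → Bool) : ℝ :=
  ∏ i, (1 + x i * sg (X i)) / 2

/-- halfspace indicator -/
noncomputable def F {n : ℕ} (v : Fin n → ℝ) (t : ℝ) (X : Fin n → Bool) : ℝ :=
  if t < ∑ i, v i * sg (X i) then 1 else 0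

/-- pivotality indicator -/
noncomputable def piv {n : ℕ} (v : Fin n → ℝ) (t : ℝ) (X : Fin n → Bool) (k : Fin n) : ℝ :=
  |F v t X - F v t (fl X k)|

/-- expected number of pivotal coordinates -/
noncomputable def N {n : ℕ} (v : Fin n → ℝ) (t : ℝ) (x : Fin n → ℝ) : ℝ :=
  ∑ k, ∑ X, W x X * piv v t X k

/-- sign vector -/
noncomputable def s {n : ℕ} (v : Fin n → ℝ) (i : Fin n) : ℝ := if 0 ≤ v i then 1 else -1

lemma sg_not (b : Bool) : sg (!b) = - sg b := by cases b <;> simp [sg]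

lemma fl_fl {n : ℕ} (X : Fin n → Bool) (k : Fin n) : fl (fl X k) k = X := by
  simp [fl]

lemma sum_fl {n : ℕ} (k : Fin n) (h : (Fin n → Bool) → ℝ) : ∑ X, h (fl X k) = ∑ X, h X :=
  Equiv.sum_comp (Function.Involutive.toPerm (fun X => fl X k) (fun X => fl_fl X k)) h

lemma sum_W {n : ℕ} (x : Fin n → ℝ) : ∑ X, W x X = 1 := by
  unfold W
  have := Finset.prod_univ_sum (fun _ : Fin n => (Finset.univ : Finset Bool))
    (fun i b => (1 + x i * sg b) / 2)
  rw [Fintype.piFinset_univ] at this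
  rw [← this]
  apply Finset.prod_eq_one
  intro i _
  simp [sg]
  ring

lemma abs_s {n : ℕ} (v : Fin n → ℝ) (i : Fin n) : |s v i| = 1 := by
  unfold s; split_ifs <;> simp

lemma W_nonneg {n : ℕ} (x : Fin n → ℝ) (hx : ∀ i, |x i| ≤ 1) (X : Fin n → Bool) : 0 ≤ W x X := by
  apply Finset.prod_nonneg
  intro i _
  have := abs_le.1 (hx i)
  cases X i <;> simp [sg] <;> linarith

lemma F_nonneg {n : ℕ} (v : Fin n → ℝ) (t : ℝ) (X : Fin n → Bool) : 0 ≤ F v t X := by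
  unfold F; split_ifs <;> simp

lemma F_le {n : ℕ} (v : Fin n → ℝ) (t : ℝ) (X : Fin n → Bool) : F v t X ≤ 1 := by
  unfold F; split_ifs <;> simp

/-- product without `k` -/
noncomputable def P {n : ℕ} (x : Fin n → ℝ) (X : Fin n → Bool) (k : Fin n) : ℝ :=
  ∏ i ∈ Finset.univ.erase k, (1 + x i * sg (X i)) / 2

lemma P_fl {n : ℕ} (x : Fin n → ℝ) (X : Fin n → Bool) (k : Fin n) : P x (fl X k) k = P x X k := by
  apply Finset.prod_congr rfl
  intro i hi
  simp [fl, Finset.ne_of_mem_erase hi]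

lemma W_eq {n : ℕ} (x : Fin n → ℝ) (X : Fin n → Bool) (k : Fin n) :
    W x X = (1 + x k * sg (X k)) / 2 * P x X k :=
  (Finset.mul_prod_erase Finset.univ (fun i => (1 + x i * sg (X i)) / 2) (Finset.mem_univ k)).symm

lemma sum_flip {n : ℕ} (v : Fin n → ℝ) (X : Fin n → Bool) (k : Fin n) :
    ∑ i, v i * sg (fl X k i) = ∑ i, v i * sg (X i) - 2 * (v k * sg (X k)) := by
  rw [← Finset.add_sum_erase _ _ (Finset.mem_univ k),
    ← Finset.add_sum_erase _ (fun i => v i * sg (X i)) (Finset.mem_univ k)]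
  have : ∑ i ∈ Finset.univ.erase k, v i * sg (fl X k i)
      = ∑ i ∈ Finset.univ.erase k, v i * sg (X i) := by
    apply Finset.sum_congr rfl
    intro i hi
    simp [fl, Finset.ne_of_mem_erase hi]
  rw [this]
  simp [fl, sg_not]
  ring

lemma piv_eq {n : ℕ} (v : Fin n → ℝ) (t : ℝ) (X : Fin n → Bool) (k : Fin n) :
    s v k * sg (X k) * (F v t X - F v t (fl X k)) = piv v t X k := by
  unfold piv F s
  rw [sum_flip]
  generalize ∑ i, v i * sg (X i) = S
  cases X k <;> simp only [sg] <;> split_ifs <;> simp at * <;> linarith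

lemma piv_fl {n : ℕ} (v : Fin n → ℝ) (t : ℝ) (X : Fin n → Bool) (k : Fin n) :
    piv v t (fl X k) k = piv v t X k := by
  unfold piv; rw [fl_fl, abs_sub_comm]

/-- Russo-Margulis for one coordinate. -/
lemma russo {n : ℕ} (v : Fin n → ℝ) (t : ℝ) (x : Fin n → ℝ) (k : Fin n) :
    ∑ X, P x X k * (s v k * sg (X k)) * F v t X = ∑ X, W x X * piv v t X k := by
  have h1 := sum_fl k (fun X => P x X k * (s v k * sg (X k)) * F v t X)
  have h2 := sum_fl k (fun X => W x X * piv v t X k)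
  have h3 : ∑ X, (P x X k * (s v k * sg (X k)) * F v t X
      + P x (fl X k) k * (s v k * sg (fl X k k)) * F v t (fl X k))
      = ∑ X, (W x X * piv v t X k + W x (fl X k) * piv v t (fl X k) k) := by
    apply Finset.sum_congr rfl
    intro X _
    rw [piv_fl, W_eq x X k, W_eq x (fl X k) k, P_fl, ← piv_eq]
    simp only [fl, Function.update_self, sg_not]
    ring
  rw [Finset.sum_add_distrib, Finset.sum_add_distrib] at h3
  linarith

lemma deriv_path {n : ℕ} (v : Fin n → ℝ) (t τ : ℝ) (r : Fin n → ℝ) (y : ℝ) :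
    HasDerivAt (fun y => ∑ X, W (fun i => r i + τ * y * s v i) X * F v t X)
      (τ / 2 * N v t (fun i => r i + τ * y * s v i)) y := by
  have h : ∀ X, HasDerivAt (fun y => W (fun i => r i + τ * y * s v i) X * F v t X)
      ((∑ k, P (fun i => r i + τ * y * s v i) X k • (τ * s v k * sg (X k) / 2)) * F v t X) y := by
    intro X
    apply HasDerivAt.mul_const
    unfold W P
    apply HasDerivAt.fun_finsetProd
    intro i _
    have h1 := ((((((hasDerivAt_id y).const_mul τ).mul_const (s v i)).const_add (r i)).mul_const
      (sg (X i))).const_add 1).div_const 2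
    simpa using h1
  have h2 := HasDerivAt.fun_sum (fun X (_ : X ∈ Finset.univ) => h X)
  refine h2.congr_deriv ?_
  symm
  unfold N
  simp_rw [← russo, Finset.sum_mul, Finset.mul_sum]
  rw [Finset.sum_comm]
  apply Finset.sum_congr rfl
  intro X _
  apply Finset.sum_congr rfl
  intro k _
  simp only [smul_eq_mul]
  ring

lemma N_nonneg {n : ℕ} (v : Fin n → ℝ) (t : ℝ) (x : Fin n → ℝ) (hx : ∀ i, |x i| ≤ 1) :
    0 ≤ N v t x :=
  Finset.sum_nonneg fun _ _ => Finset.sum_nonneg fun X _ =>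
    mul_nonneg (W_nonneg x hx X) (abs_nonneg _)

lemma N_continuous {n : ℕ} (v : Fin n → ℝ) (t : ℝ) : Continuous (N v t) := by
  unfold N W; fun_prop

/-- grid points -/
noncomputable def yy (G : ℕ) (a : ℕ) : ℝ := (2 * a + 1 - G) / G

lemma yy_abs {G : ℕ} (a : Fin G) : |yy G a| ≤ 1 := by
  have hG : (0 : ℝ) < G := by exact_mod_cast a.pos
  have : (a : ℝ) + 1 ≤ G := by exact_mod_cast a.2
  have h0 : (0 : ℝ) ≤ (a : ℕ) := by positivity
  unfold yy
  rw [abs_div, abs_of_pos hG, div_le_one hG, abs_le]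
  constructor <;> linarith

lemma yy_rev {G : ℕ} (a : Fin G) : yy G (Fin.rev a) = - yy G a := by
  unfold yy
  have : ((Fin.rev a : ℕ) : ℝ) = G - (a + 1) := by
    rw [Fin.val_rev, Nat.cast_sub (by omega)]; push_cast; ring
  rw [this]; ring

/-- one line of the grid -/
lemma line_bound {n : ℕ} (v : Fin n → ℝ) (t τ : ℝ) (hτ : 0 < τ) (r : Fin n → ℝ)
    (hr : ∀ i, |r i| ≤ 1 - τ) (G : ℕ) (hG : 0 < G)
    (hc : ∀ y z : ℝ, |y| ≤ 1 → |z| ≤ 1 → |y - z| ≤ 1 / G →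
      N v t (fun i => r i + τ * y * s v i) ≤ N v t (fun i => r i + τ * z * s v i) + 1) :
    ∑ a : Fin G, N v t (fun i => r i + τ * yy G a * s v i) ≤ G * (1 / τ + 1) := by
  have hG' : (0 : ℝ) < G := by exact_mod_cast hG
  set ψ : ℝ → ℝ := fun y => ∑ X, W (fun i => r i + τ * y * s v i) X * F v t X with hψ
  have hx : ∀ y : ℝ, |y| ≤ 1 → ∀ i, |r i + τ * y * s v i| ≤ 1 := by
    intro y hy i
    calc |r i + τ * y * s v i| ≤ |r i| + |τ * y * s v i| := abs_add_le _ _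
      _ = |r i| + τ * |y| := by rw [abs_mul, abs_mul, abs_s, abs_of_pos hτ, mul_one]
      _ ≤ 1 := by nlinarith [hr i]
  have h0 : 0 ≤ ψ (-1) := Finset.sum_nonneg fun X _ =>
    mul_nonneg (W_nonneg _ (hx (-1) (by simp)) X) (F_nonneg _ _ _)
  have h1 : ψ 1 ≤ 1 := by
    refine le_trans ?_ (sum_W (fun i => r i + τ * 1 * s v i)).le
    apply Finset.sum_le_sum
    intro X _
    exact mul_le_of_le_one_right (W_nonneg _ (hx 1 (by simp)) X) (F_le _ _ _)
  set z : ℕ → ℝ := fun a => (2 * a - G) / G with hz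
  have key : ∀ a : ℕ, a < G → N v t (fun i => r i + τ * yy G a * s v i)
      ≤ G / τ * (ψ (z (a + 1)) - ψ (z a)) + 1 := by
    intro a ha
    have ha' : (a : ℝ) + 1 ≤ G := by exact_mod_cast ha
    have ha0 : (0 : ℝ) ≤ a := by positivity
    have hzz : z (a + 1) - z a = 2 / G := by
      simp only [hz]; push_cast; field_simp; ring
    have hlt : z a < z (a + 1) := by
      have : (0 : ℝ) < 2 / G := by positivity
      linarith
    obtain ⟨ξ, hξ, he⟩ := exists_hasDerivAt_eq_slope ψ _ hlt
      (fun y _ => (deriv_path v t τ r y).continuousAt.continuousWithinAt)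
      (fun y _ => deriv_path v t τ r y)
    have hza : -1 ≤ z a := by
      simp only [hz]; rw [le_div_iff₀ hG']; linarith
    have hzb : z (a + 1) ≤ 1 := by
      simp only [hz]; rw [div_le_iff₀ hG']; push_cast; linarith
    have hyz : yy G a = z a + 1 / G := by
      simp only [hz, yy]; field_simp; ring
    have h12 : (2 : ℝ) / G = 1 / G + 1 / G := by ring
    have hcc := hc (yy G a) ξ (yy_abs ⟨a, ha⟩)
      (abs_le.2 ⟨by linarith [hξ.1], by linarith [hξ.2]⟩)
      (abs_le.2 ⟨by linarith [hξ.2], by linarith [hξ.1]⟩)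
    rw [hzz] at he
    have : N v t (fun i => r i + τ * ξ * s v i) = G / τ * (ψ (z (a + 1)) - ψ (z a)) := by
      field_simp at he ⊢
      linarith
    linarith
  rw [Fin.sum_univ_eq_sum_range (fun a => N v t (fun i => r i + τ * yy G a * s v i)) G]
  calc _ ≤ ∑ a ∈ Finset.range G, (G / τ * (ψ (z (a + 1)) - ψ (z a)) + 1) :=
        Finset.sum_le_sum fun a ha => key a (Finset.mem_range.1 ha)
    _ = G / τ * (ψ (z G) - ψ (z 0)) + G := by
        rw [Finset.sum_add_distrib, ← Finset.mul_sum, Finset.sum_range_sub (fun a => ψ (z a))]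
        simp
    _ ≤ G * (1 / τ + 1) := by
        have e1 : z G = 1 := by simp only [hz]; field_simp; ring
        have e0 : z 0 = -1 := by simp only [hz]; field_simp; simp
        rw [e1, e0]
        have : G / τ * (ψ 1 - ψ (-1)) ≤ G / τ * 1 :=
          mul_le_mul_of_nonneg_left (by linarith) (by positivity)
        have e2 : (G : ℝ) * (1 / τ + 1) = G / τ * 1 + G := by ring
        linarith

lemma sum_update {m G : ℕ} (l : Fin m) (f : (Fin m → Fin G) → ℝ) :
    ∑ g, ∑ a, f (Function.update g l a) = G * ∑ g, f g := by
  have h : ∀ f : (Fin m → Fin G) → ℝ, ∑ g, f g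
      = ∑ p : Fin G × ({j // j ≠ l} → Fin G), f ((Equiv.funSplitAt l (Fin G)).symm p) :=
    fun f => (Equiv.sum_comp (Equiv.funSplitAt l (Fin G)).symm f).symm
  have h2 : ∀ (p : Fin G × ({j // j ≠ l} → Fin G)) a,
      Function.update ((Equiv.funSplitAt l (Fin G)).symm p) l a
        = (Equiv.funSplitAt l (Fin G)).symm (a, p.2) := by
    intro p a
    ext i
    by_cases hi : i = l
    · subst hi; simp [Equiv.funSplitAt, Equiv.piSplitAt]
    · simp [Equiv.funSplitAt, Equiv.piSplitAt, hi]
  rw [h, h f]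
  simp_rw [h2]
  rw [Fintype.sum_prod_type, Fintype.sum_prod_type]
  simp only [Finset.sum_const, Finset.card_univ, Fintype.card_fin, nsmul_eq_mul]
  rw [Finset.sum_comm]

lemma mgf_one (G : ℕ) (b : ℝ) : ∑ a : Fin G, Real.exp (b * yy G a) ≤ G * Real.exp (b ^ 2 / 2) := by
  have h : ∑ a : Fin G, Real.exp (b * yy G a) = ∑ a : Fin G, Real.exp (-(b * yy G a)) := by
    rw [← Equiv.sum_comp Fin.revPerm]
    apply Finset.sum_congr rfl
    intro a _
    rw [Fin.revPerm_apply, yy_rev]; ring_nf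
  have h2 : ∑ a : Fin G, Real.exp (b * yy G a) = ∑ a : Fin G, Real.cosh (b * yy G a) := by
    simp_rw [Real.cosh_eq]
    rw [← Finset.sum_div, Finset.sum_add_distrib, ← h]; ring
  rw [h2]
  calc _ ≤ ∑ a : Fin G, Real.exp (b ^ 2 / 2) := by
        apply Finset.sum_le_sum
        intro a _
        refine (Real.cosh_le_exp_half_sq _).trans ?_
        apply Real.exp_le_exp.2
        have := yy_abs a
        have h3 : (yy G a) ^ 2 ≤ 1 := (sq_le_one_iff_abs_le_one _).2 this
        rw [mul_pow]
        nlinarith [sq_nonneg b]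
    _ = _ := by simp

lemma mgf {m G : ℕ} (w : Fin m → ℝ) (hw : ∀ l, |w l| = 1) (b : ℝ) :
    ∑ g : Fin m → Fin G, Real.exp (b * ∑ l, yy G (g l) * w l)
      ≤ (G : ℝ) ^ m * Real.exp (m * b ^ 2 / 2) := by
  have := Finset.prod_univ_sum (fun _ : Fin m => (Finset.univ : Finset (Fin G)))
    (fun l a => Real.exp (b * w l * yy G a))
  rw [Fintype.piFinset_univ] at this
  calc _ = ∑ g : Fin m → Fin G, ∏ l, Real.exp (b * w l * yy G (g l)) := by
        apply Finset.sum_congr rfl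
        intro g _
        rw [← Real.exp_sum, Finset.mul_sum]
        congr 1
        apply Finset.sum_congr rfl
        intro l _; ring
    _ = ∏ l, ∑ a : Fin G, Real.exp (b * w l * yy G a) := this.symm
    _ ≤ ∏ l : Fin m, (G * Real.exp (b ^ 2 / 2)) := by
        apply Finset.prod_le_prod
        · intro l _; positivity
        · intro l _
          refine (mgf_one G _).trans ?_
          rw [mul_pow, ← sq_abs (w l), hw]; simp
    _ = _ := by
        rw [Finset.prod_const, mul_pow, ← Real.exp_nat_mul]
        simp; left; ring

open Classical in
lemma tail {m G : ℕ} (w : Fin m → ℝ) (hw : ∀ l, |w l| = 1) (b T : ℝ) (hb : 0 ≤ b) :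
    ((Finset.univ.filter (fun g : Fin m → Fin G => T < |∑ l, yy G (g l) * w l|)).card : ℝ)
      ≤ 2 * ((G : ℝ) ^ m * Real.exp (m * b ^ 2 / 2 - b * T)) := by
  have h1 := mgf (G := G) w hw b
  have h2 := mgf (G := G) w hw (-b)
  have h3 : ((Finset.univ.filter (fun g : Fin m → Fin G => T < |∑ l, yy G (g l) * w l|)).card : ℝ)
      * Real.exp (b * T) ≤ ∑ g : Fin m → Fin G, (Real.exp (b * ∑ l, yy G (g l) * w l)
        + Real.exp (-b * ∑ l, yy G (g l) * w l)) := by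
    rw [← nsmul_eq_mul, ← Finset.sum_const]
    refine le_trans (Finset.sum_le_sum ?_) (Finset.sum_le_sum_of_subset_of_nonneg
      (Finset.filter_subset _ _) (fun g _ _ => by positivity))
    intro g hg
    have hg := (Finset.mem_filter.1 hg).2
    rcases lt_abs.1 hg with h | h
    · have : Real.exp (b * T) ≤ Real.exp (b * ∑ l, yy G (g l) * w l) :=
        Real.exp_le_exp.2 (mul_le_mul_of_nonneg_left h.le hb)
      linarith [Real.exp_pos (-b * ∑ l, yy G (g l) * w l)]
    · have : Real.exp (b * T) ≤ Real.exp (-b * ∑ l, yy G (g l) * w l) :=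
        Real.exp_le_exp.2 (by nlinarith)
      linarith [Real.exp_pos (b * ∑ l, yy G (g l) * w l)]
  rw [Finset.sum_add_distrib] at h3
  rw [neg_sq] at h2
  rw [Real.exp_sub, ← mul_div_assoc, ← mul_div_assoc, le_div_iff₀ (Real.exp_pos _)]
  linarith

/-- mean vector attached to a parameter vector -/
noncomputable def mean {n m : ℕ} (v : Fin m → Fin n → ℝ) (τ : ℝ) (g : Fin m → ℝ) (i : Fin n) : ℝ :=
  τ * ∑ l, g l * s (v l) i

lemma mean_update {n m : ℕ} (v : Fin m → Fin n → ℝ) (τ : ℝ) (g : Fin m → ℝ) (l : Fin m) (y : ℝ) :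
    mean v τ (Function.update g l y)
      = fun i => mean v τ (Function.update g l 0) i + τ * y * s (v l) i := by
  funext i
  unfold mean
  rw [← Finset.add_sum_erase _ _ (Finset.mem_univ l),
    ← Finset.add_sum_erase _ (fun j => Function.update g l 0 j * s (v j) i) (Finset.mem_univ l)]
  have : ∀ y : ℝ, ∑ j ∈ Finset.univ.erase l, Function.update g l y j * s (v j) i
      = ∑ j ∈ Finset.univ.erase l, g j * s (v j) i := by
    intro y
    apply Finset.sum_congr rfl
    intro j hj
    simp [Finset.ne_of_mem_erase hj]
  rw [this, this]
  simp only [Function.update_self]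
  ring

lemma unif {n m : ℕ} (v : Fin m → Fin n → ℝ) (t : Fin m → ℝ) (τ : ℝ) :
    ∃ G : ℕ, 0 < G ∧ ∀ l, ∀ g : Fin m → ℝ, (∀ j, |g j| ≤ 1) → ∀ y z : ℝ, |y| ≤ 1 → |z| ≤ 1 →
      |y - z| ≤ 1 / G →
      N (v l) (t l) (mean v τ (Function.update g l y))
        ≤ N (v l) (t l) (mean v τ (Function.update g l z)) + 1 := by
  have hcont : ∀ l, Continuous (fun g => N (v l) (t l) (mean v τ g)) := by
    intro l
    apply (N_continuous _ _).comp
    unfold mean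
    fun_prop
  have hK : IsCompact (Metric.closedBall (0 : Fin m → ℝ) 1) := isCompact_closedBall _ _
  have h1 : ∀ l, ∃ δ > 0, ∀ g ∈ Metric.closedBall (0 : Fin m → ℝ) 1,
      ∀ g' ∈ Metric.closedBall (0 : Fin m → ℝ) 1, dist g g' < δ →
      dist (N (v l) (t l) (mean v τ g)) (N (v l) (t l) (mean v τ g')) < 1 := by
    intro l
    exact Metric.uniformContinuousOn_iff.1
      (hK.uniformContinuousOn_of_continuous (hcont l).continuousOn) 1 one_pos
  choose δ hδ h using h1
  have h2 : ∃ ε > 0, ∀ l, ε ≤ δ l := by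
    by_cases hm : Nonempty (Fin m)
    · obtain ⟨l0, h0⟩ := Finite.exists_min δ
      exact ⟨δ l0, hδ l0, h0⟩
    · exact ⟨1, one_pos, fun l => (hm ⟨l⟩).elim⟩
  obtain ⟨ε, hε, hεδ⟩ := h2
  obtain ⟨k, hk⟩ := exists_nat_one_div_lt hε
  refine ⟨k + 1, k.succ_pos, ?_⟩
  intro l g hg y z hy hz hyz
  have hmem : ∀ y : ℝ, |y| ≤ 1 → Function.update g l y ∈ Metric.closedBall (0 : Fin m → ℝ) 1 := by
    intro y hy
    rw [mem_closedBall_zero_iff, pi_norm_le_iff_of_nonneg zero_le_one]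
    intro j
    by_cases hj : j = l
    · subst hj; simpa using hy
    · simpa [hj] using hg j
  have hd : dist (Function.update g l y) (Function.update g l z) < δ l := by
    refine lt_of_lt_of_le ?_ (hεδ l)
    rw [dist_pi_lt_iff hε]
    intro j
    by_cases hj : j = l
    · subst hj
      simp only [Function.update_self, Real.dist_eq]
      refine lt_of_le_of_lt hyz ?_
      push_cast; exact hk
    · simpa [hj] using hε
  have := h l _ (hmem y hy) _ (hmem z hz) hd
  rw [Real.dist_eq] at this
  linarith [(abs_lt.1 this).2]

open Classical in
lemma main_bound {n m : ℕ} (v : Fin m → Fin n → ℝ) (t : Fin m → ℝ)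
    (hcov : ∀ X k, ∃ l, piv (v l) (t l) X k = 1) (τ : ℝ) (hτ : 0 < τ) (hτ4 : τ ≤ 1 / 4)
    (hτm : 2 * n * Real.exp (- (1 / (8 * m * τ ^ 2))) ≤ 1 / 2) (hm : 0 < m) :
    (n : ℝ) ≤ 2 * (m * (1 / τ + 1)) := by
  obtain ⟨G, hG, hun⟩ := unif v t τ
  have hG' : (0 : ℝ) < G := by exact_mod_cast hG
  have hm' : (0 : ℝ) < m := by exact_mod_cast hm
  let Y : (Fin m → Fin G) → (Fin m → ℝ) := fun g l => yy G (g l)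
  have hY : ∀ g j, |Y g j| ≤ 1 := fun g j => yy_abs (g j)
  have hYu : ∀ g l a, Y (Function.update g l a) = Function.update (Y g) l (yy G a) := by
    intro g l a
    funext j
    by_cases hj : j = l
    · subst hj; simp [Y]
    · simp [Y, hj]
  let good : Finset (Fin m → Fin G) := Finset.univ.filter fun g => ∀ i, |mean v τ (Y g) i| ≤ 1 / 2
  -- size of good set
  have hgood : (G : ℝ) ^ m / 2 ≤ good.card := by
    have hbad : ((Finset.univ \ good).card : ℝ) ≤ (G : ℝ) ^ m / 2 := by
      have hsub : Finset.univ \ good ⊆ Finset.univ.biUnion (fun i : Fin n =>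
          Finset.univ.filter (fun g : Fin m → Fin G =>
            1 / (2 * τ) < |∑ l, yy G (g l) * s (v l) i|)) := by
        intro g hg
        simp only [good, Finset.mem_sdiff, Finset.mem_univ, true_and, Finset.mem_filter,
          not_forall, not_le] at hg
        obtain ⟨i, hi⟩ := hg
        simp only [Finset.mem_biUnion, Finset.mem_univ, true_and, Finset.mem_filter]
        refine ⟨i, ?_⟩
        unfold mean at hi
        rw [abs_mul, abs_of_pos hτ] at hi
        rw [div_lt_iff₀ (by positivity)]
        simp only [Y] at hi
        linarith
      have hcard := (Finset.card_le_card hsub).trans Finset.card_biUnion_le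
      have hcard' : ((Finset.univ \ good).card : ℝ) ≤ ∑ i : Fin n,
          ((Finset.univ.filter (fun g : Fin m → Fin G =>
            1 / (2 * τ) < |∑ l, yy G (g l) * s (v l) i|)).card : ℝ) := by exact_mod_cast hcard
      refine hcard'.trans ?_
      have hb : ∀ i : Fin n, ((Finset.univ.filter (fun g : Fin m → Fin G =>
            1 / (2 * τ) < |∑ l, yy G (g l) * s (v l) i|)).card : ℝ)
            ≤ 2 * ((G : ℝ) ^ m * Real.exp (- (1 / (8 * m * τ ^ 2)))) := by
        intro i
        refine (tail (fun l => s (v l) i) (fun l => abs_s _ _) (1 / (2 * m * τ)) _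
          (by positivity)).trans (le_of_eq ?_)
        congr 3
        field_simp
        ring
      refine (Finset.sum_le_sum fun i _ => hb i).trans ?_
      rw [Finset.sum_const, Finset.card_univ, Fintype.card_fin, nsmul_eq_mul]
      have : (0 : ℝ) < (G : ℝ) ^ m := by positivity
      nlinarith
    have htot : ((Finset.univ \ good).card : ℝ) + good.card = (G : ℝ) ^ m := by
      have := Finset.card_sdiff_add_card_eq_card (Finset.subset_univ good)
      rw [Finset.card_univ, Fintype.card_fun, Fintype.card_fin, Fintype.card_fin] at this
      exact_mod_cast this
    linarith
  -- lower bound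
  have hlow : ∀ g ∈ good, (n : ℝ) ≤ ∑ l, N (v l) (t l) (mean v τ (Y g)) := by
    intro g hg
    have hg := (Finset.mem_filter.1 hg).2
    have hx : ∀ i, |mean v τ (Y g) i| ≤ 1 := fun i => (hg i).trans (by norm_num)
    unfold N
    rw [Finset.sum_comm]
    have : ∀ k : Fin n, (1 : ℝ) ≤ ∑ l, ∑ X, W (mean v τ (Y g)) X * piv (v l) (t l) X k := by
      intro k
      rw [Finset.sum_comm]
      refine (sum_W (mean v τ (Y g))).ge.trans ?_
      apply Finset.sum_le_sum
      intro X _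
      rw [← Finset.mul_sum]
      apply le_mul_of_one_le_right (W_nonneg _ hx X)
      obtain ⟨l, hl⟩ := hcov X k
      rw [← hl]
      exact Finset.single_le_sum (f := fun l => piv (v l) (t l) X k) (fun l _ => abs_nonneg _)
        (Finset.mem_univ l)
    calc (n : ℝ) = ∑ k : Fin n, (1 : ℝ) := by simp
      _ ≤ _ := Finset.sum_le_sum fun k _ => this k
  -- upper bound
  let q : Fin m → (Fin m → Fin G) → Prop := fun l g =>
    ∀ i, |mean v τ (Function.update (Y g) l 0) i| ≤ 1 - τ
  have hgq : ∀ l, ∀ g ∈ good, q l g := by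
    intro l g hg i
    have hg := (Finset.mem_filter.1 hg).2 i
    have he := congrFun (mean_update v τ (Y g) l (Y g l)) i
    rw [Function.update_eq_self] at he
    have h1 : |τ * Y g l * s (v l) i| ≤ τ := by
      rw [abs_mul, abs_mul, abs_s, abs_of_pos hτ, mul_one]
      exact mul_le_of_le_one_right hτ.le (hY g l)
    have h2 : mean v τ (Function.update (Y g) l 0) i
        = mean v τ (Y g) i - τ * Y g l * s (v l) i := by
      rw [he]; ring
    rw [h2]
    have := abs_sub (mean v τ (Y g) i) (τ * Y g l * s (v l) i)
    linarith
  have hup : ∀ l, ∑ g ∈ good, N (v l) (t l) (mean v τ (Y g)) ≤ (G : ℝ) ^ m * (1 / τ + 1) := by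
    intro l
    have hqx : ∀ g, q l g → ∀ i, |mean v τ (Y g) i| ≤ 1 := by
      intro g hg i
      have he := congrFun (mean_update v τ (Y g) l (Y g l)) i
      rw [Function.update_eq_self] at he
      have h1 : |τ * Y g l * s (v l) i| ≤ τ := by
        rw [abs_mul, abs_mul, abs_s, abs_of_pos hτ, mul_one]
        exact mul_le_of_le_one_right hτ.le (hY g l)
      rw [he]
      have := abs_add_le (mean v τ (Function.update (Y g) l 0) i) (τ * Y g l * s (v l) i)
      linarith [hg i]
    let f : (Fin m → Fin G) → ℝ := fun g =>
      if q l g then N (v l) (t l) (mean v τ (Y g)) else 0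
    have hf0 : ∀ g, 0 ≤ f g := by
      intro g
      simp only [f]
      split_ifs with h
      · exact N_nonneg _ _ _ (hqx g h)
      · exact le_rfl
    have h1 : ∑ g ∈ good, N (v l) (t l) (mean v τ (Y g)) ≤ ∑ g, f g := by
      calc _ = ∑ g ∈ good, f g := by
            apply Finset.sum_congr rfl
            intro g hg
            simp only [f]; rw [if_pos (hgq l g hg)]
        _ ≤ _ := Finset.sum_le_sum_of_subset_of_nonneg (Finset.subset_univ _) fun g _ _ => hf0 g
    have h2 : ∀ g, ∑ a, f (Function.update g l a) ≤ G * (1 / τ + 1) := by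
      intro g
      have hqa : ∀ a, q l (Function.update g l a) ↔ q l g := by
        intro a
        simp only [q, hYu, Function.update_idem]
      by_cases hq : q l g
      · have : ∀ a : Fin G, f (Function.update g l a) = N (v l) (t l)
            (fun i => mean v τ (Function.update (Y g) l 0) i + τ * yy G a * s (v l) i) := by
          intro a
          simp only [f]
          rw [if_pos ((hqa a).2 hq), hYu, mean_update]
        rw [Finset.sum_congr rfl fun a _ => this a]
        apply line_bound _ _ _ hτ _ hq _ hG
        intro y z hy hz hyz
        have := hun l (Y g) (hY g) y z hy hz hyz
        rwa [mean_update, mean_update v τ (Y g) l z] at this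
      · have : ∀ a : Fin G, f (Function.update g l a) = 0 := by
          intro a
          simp only [f]
          rw [if_neg (fun h => hq ((hqa a).1 h))]
        rw [Finset.sum_congr rfl fun a _ => this a]
        simp only [Finset.sum_const_zero]
        positivity
    have h3 : G * ∑ g, f g ≤ G * ((G : ℝ) ^ m * (1 / τ + 1)) := by
      rw [← sum_update l f]
      refine (Finset.sum_le_sum fun g _ => h2 g).trans (le_of_eq ?_)
      rw [Finset.sum_const, Finset.card_univ, Fintype.card_fun, Fintype.card_fin, Fintype.card_fin,
        nsmul_eq_mul]
      push_cast
      ring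
    exact h1.trans (le_of_mul_le_mul_left h3 hG')
  have hfin : good.card * (n : ℝ) ≤ m * ((G : ℝ) ^ m * (1 / τ + 1)) := by
    calc good.card * (n : ℝ) = ∑ g ∈ good, (n : ℝ) := by simp
      _ ≤ ∑ g ∈ good, ∑ l, N (v l) (t l) (mean v τ (Y g)) := Finset.sum_le_sum hlow
      _ = ∑ l, ∑ g ∈ good, N (v l) (t l) (mean v τ (Y g)) := Finset.sum_comm
      _ ≤ ∑ l : Fin m, (G : ℝ) ^ m * (1 / τ + 1) := Finset.sum_le_sum fun l _ => hup l
      _ = _ := by simp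
  have hGm : (0 : ℝ) < (G : ℝ) ^ m := by positivity
  have hn : (G : ℝ) ^ m / 2 * n ≤ good.card * (n : ℝ) :=
    mul_le_mul_of_nonneg_right hgood (by positivity)
  have : (G : ℝ) ^ m * n ≤ (G : ℝ) ^ m * (2 * (m * (1 / τ + 1))) := by linarith
  exact le_of_mul_le_mul_left this hGm

lemma dissect_piv {n : ℕ} (v : Fin n → ℝ) (t : ℝ) (X : Fin n → Bool) (k : Fin n)
    (h : dissectsEdge v t (fun i => sg (X i)) k) : piv v t X k = 1 := by
  obtain ⟨⟨y, hy, hyt⟩, hA, hB⟩ := h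
  have hfl : flipCoord (fun i => sg (X i)) k = fun i => sg (fl X k i) := by
    funext i
    unfold flipCoord fl
    by_cases hi : i = k
    · subst hi; simp [sg_not]
    · simp [hi]
  rw [hfl] at hy hB
  obtain ⟨a, b, ha, hb, hab, rfl⟩ := hy
  unfold piv F
  have he : a * (∑ i, v i * sg (X i)) + b * (∑ i, v i * sg (fl X k i)) = t := by
    rw [← hyt, Finset.mul_sum, Finset.mul_sum, ← Finset.sum_add_distrib]
    apply Finset.sum_congr rfl
    intro i _
    simp only [Pi.add_apply, Pi.smul_apply, smul_eq_mul]
    ring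
  simp only at hA hB
  generalize ∑ i, v i * sg (X i) = A at *
  generalize ∑ i, v i * sg (fl X k i) = B at *
  have hb' : b = 1 - a := by linarith
  subst hb'
  split_ifs with h1 h2 h2
  · exfalso
    rcases ha.lt_or_eq with h | h
    · nlinarith [mul_pos h (sub_pos.2 h1), mul_nonneg hb (sub_pos.2 h2).le]
    · subst h; apply hB; linarith
  · norm_num
  · norm_num
  · exfalso
    have h1' : A < t := lt_of_le_of_ne (not_lt.1 h1) hA
    have h2' : B < t := lt_of_le_of_ne (not_lt.1 h2) hB
    rcases ha.lt_or_eq with h | h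
    · nlinarith [mul_pos h (sub_pos.2 h1'), mul_nonneg hb (sub_pos.2 h2').le]
    · subst h; apply hB; linarith

lemma cube_bound {n m : ℕ} (hn : 2 ≤ n) (v : Fin m → Fin n → ℝ) (t : Fin m → ℝ)
    (hcov : ∀ X k, ∃ l, piv (v l) (t l) X k = 1) :
    (n : ℝ) ^ 2 ≤ 384 * m ^ 3 * Real.log n := by
  have hm : 0 < m := by
    obtain ⟨l, _⟩ := hcov (fun _ => true) ⟨0, by omega⟩
    exact l.pos
  have hm1 : (1 : ℝ) ≤ m := by exact_mod_cast hm
  have hn2 : (2 : ℝ) ≤ n := by exact_mod_cast hn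
  set L := Real.log (4 * n) with hL
  have hL2 : 2 ≤ L := by
    rw [hL, Real.le_log_iff_exp_le (by positivity)]
    have h1 : Real.exp 2 = Real.exp 1 * Real.exp 1 := by rw [← Real.exp_add]; norm_num
    have h2 := Real.exp_one_lt_d9
    have h3 := Real.exp_pos 1
    nlinarith
  have hL3 : L ≤ 3 * Real.log n := by
    have : (3 : ℝ) * Real.log n = Real.log ((n : ℝ) ^ 3) := by rw [Real.log_pow]; norm_num
    rw [this, hL]
    apply Real.log_le_log (by positivity)
    nlinarith [mul_self_nonneg ((n : ℝ) - 2)]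
  have hR : (16 : ℝ) ≤ 8 * m * L := by nlinarith
  have hR0 : (0 : ℝ) < 8 * m * L := by linarith
  set R := Real.sqrt (8 * m * L) with hRd
  have hR4 : 4 ≤ R := by
    apply Real.le_sqrt_of_sq_le; linarith
  have hRsq : R ^ 2 = 8 * m * L := Real.sq_sqrt hR0.le
  have hb := main_bound v t hcov (1 / R) (by positivity)
    (by apply one_div_le_one_div_of_le <;> linarith) (by
      have : - (1 / (8 * (m : ℝ) * (1 / R) ^ 2)) = - L := by
        rw [div_pow, hRsq]; field_simp
      rw [this, Real.exp_neg, hL, Real.exp_log (by positivity)]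
      field_simp; norm_num) hm
  have hb2 : (n : ℝ) ≤ 4 * m * R := by
    rw [one_div_one_div] at hb
    nlinarith
  calc (n : ℝ) ^ 2 ≤ (4 * m * R) ^ 2 := by gcongr
    _ = 128 * m ^ 3 * L := by rw [mul_pow, hRsq]; ring
    _ ≤ 128 * m ^ 3 * (3 * Real.log n) := by gcongr
    _ = _ := by ring

end CubeSlice

/-- Theorem 1.1: there is an absolute constant `c > 0` such that for every
`n ≥ 2`, any family of `m` hyperplanes in `ℝ^n` dissecting every edge of the `n`-cube
satisfies `m ≥ c · n^(2/3) / (log n)^(4/3)`. -/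
theorem stmt_0 :
    ∃ c : ℝ, 0 < c ∧
      ∀ n : ℕ, 2 ≤ n →
        ∀ (m : ℕ) (v : Fin m → Fin n → ℝ) (t : Fin m → ℝ),
          (∀ ℓ, v ℓ ≠ 0) →
          (∀ u : Fin n → ℝ, isCubeVertex u → ∀ k : Fin n,
            ∃ ℓ, dissectsEdge (v ℓ) (t ℓ) u k) →
          c * (n : ℝ) ^ ((2 : ℝ) / 3) / Real.log n ^ ((4 : ℝ) / 3) ≤ m := by
  refine ⟨1 / 16, by norm_num, ?_⟩
  intro n hn m v t _ hcov
  have hb := CubeSlice.cube_bound hn v t (by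
    intro X k
    obtain ⟨l, hl⟩ := hcov (fun i => CubeSlice.sg (X i)) (by
      intro i
      simp only [CubeSlice.sg]
      split_ifs <;> simp) k
    exact ⟨l, CubeSlice.dissect_piv _ _ _ _ hl⟩)
  have hn2 : (2 : ℝ) ≤ n := by exact_mod_cast hn
  have hlog : 1 / 2 ≤ Real.log n := by
    have := Real.log_le_log (by norm_num) hn2
    linarith [Real.log_two_gt_d9]
  have hlog0 : 0 < Real.log n := by linarith
  apply le_of_pow_le_pow_left₀ (n := 3) (by norm_num) (by positivity)
  rw [div_pow, mul_pow, ← Real.rpow_natCast ((n : ℝ) ^ ((2 : ℝ) / 3)) 3,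
    ← Real.rpow_natCast ((Real.log n) ^ ((4 : ℝ) / 3)) 3,
    ← Real.rpow_mul (by positivity), ← Real.rpow_mul hlog0.le]
  have e1 : (2 : ℝ) / 3 * ((3 : ℕ) : ℝ) = ((2 : ℕ) : ℝ) := by norm_num
  have e2 : (4 : ℝ) / 3 * ((3 : ℕ) : ℝ) = ((4 : ℕ) : ℝ) := by norm_num
  rw [e1, e2, Real.rpow_natCast, Real.rpow_natCast, div_le_iff₀ (by positivity)]
  have h3 : (1 / 2 : ℝ) ^ 3 ≤ Real.log n ^ 3 := by gcongr
  have h4 : (m : ℝ) ^ 3 * Real.log n * (1 / 2 : ℝ) ^ 3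
      ≤ (m : ℝ) ^ 3 * Real.log n * Real.log n ^ 3 := by gcongr
  have h5 : (m : ℝ) ^ 3 * Real.log n ^ 4 = (m : ℝ) ^ 3 * Real.log n * Real.log n ^ 3 := by ring
  have h6 : (0 : ℝ) ≤ (m : ℝ) ^ 3 * Real.log n := by positivity
  rw [h5]
  nlinarith
end

section
/- There is an absolute constant C > 0 such that the following holds. Let n, m ≥ 2 and let H_1, …, H_m be hyperplanes in ℝ^n, with H_ℓ = {x ∈ ℝ^n : ⟨v_ℓ, x⟩ = t_ℓ} where ‖v_ℓ‖_2 = 1 and t_ℓ ∈ ℝ. Then there exists a probability distribution over edges of the n-cube graph Q_n such that for every ℓ ∈ {1,…,m}, the probability that a random edge drawn from this distribution crosses H_ℓ is at most C · √m · (log n)^2 / n. -/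
open MeasureTheory

/-- The edge of the `n`-cube joining `u` and `u` with its `k`-th sign flipped crosses the
hyperplane `{x | ⟨v, x⟩ = t}`: the hyperplane meets the segment between the two
endpoints but contains neither endpoint. -/
def edgeCrosses {n : ℕ} (v : Fin n → ℝ) (t : ℝ) (u : Fin n → ℝ) (k : Fin n) : Prop :=
  (∃ y ∈ segment ℝ u (flipCoord u k), ∑ i, v i * y i = t) ∧
    (∑ i, v i * u i ≠ t) ∧ (∑ i, v i * flipCoord u k i ≠ t)

noncomputable section CubeProof

/-- Uniform probability measure on `[-1/2, 1/2]`. -/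
def nuU : Measure ℝ := volume.restrict (Set.Ioc (-1/2) (1/2))

instance nuU_prob : IsProbabilityMeasure nuU := by
  constructor
  simp [nuU]
  norm_num

/-- Uniform probability measure on the box `[-1/2, 1/2]^m`. -/
def muU (m : ℕ) : Measure (Fin m → ℝ) := Measure.pi fun _ => nuU

instance muU_prob (m : ℕ) : IsProbabilityMeasure (muU m) := by
  unfold muU; infer_instance

lemma muU_int_deriv_le {m : ℕ} (ℓ : Fin m) (G G' : (Fin m → ℝ) → ℝ) (hG' : Continuous G')
    (hi : Integrable G' (muU m))
    (hd : ∀ ξ, HasDerivAt (fun r => G (Function.update ξ ℓ r)) (G' ξ) (ξ ℓ)) (c : ℝ)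
    (hc : ∀ ξ, G (Function.update ξ ℓ (1/2)) - G (Function.update ξ ℓ (-1/2)) ≤ c) :
    ∫ ξ, G' ξ ∂(muU m) ≤ c := by
  obtain _ | k := m
  · exact ℓ.elim0
  have hmp := (measurePreserving_piFinSuccAbove (fun _ : Fin (k+1) => nuU) ℓ).symm
  have hmp' : MeasurePreserving (MeasurableEquiv.piFinSuccAbove (fun _ : Fin (k+1) => ℝ) ℓ).symm
      (nuU.prod (muU k)) (muU (k+1)) := hmp
  rw [← hmp'.integral_comp' G', integral_prod_symm]
  swap
  · exact (hmp'.integrable_comp_emb (MeasurableEquiv.measurableEmbedding _)).2 hi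
  have key : ∀ y : Fin k → ℝ, ∫ x, G' ((MeasurableEquiv.piFinSuccAbove (fun _ => ℝ) ℓ).symm (x, y)) ∂nuU ≤ c := by
    intro y
    simp only [MeasurableEquiv.piFinSuccAbove_symm_apply, Fin.insertNthEquiv, Equiv.coe_fn_mk, nuU]
    rw [← intervalIntegral.integral_of_le (by norm_num)]
    rw [intervalIntegral.integral_eq_sub_of_hasDerivAt (f := fun x => G (ℓ.insertNth x y))]
    · have := hc (ℓ.insertNth 0 y)
      simpa only [Fin.update_insertNth] using this
    · intro x _
      have := hd (ℓ.insertNth x y)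
      simpa only [Fin.update_insertNth, Fin.insertNth_apply_same] using this
    · apply Continuous.intervalIntegrable
      apply hG'.comp
      exact Continuous.finInsertNth ℓ continuous_id continuous_const
  calc _ ≤ ∫ y, c ∂(muU k) := by
        refine integral_mono ?_ (integrable_const c) fun y => key y
        exact ((hmp'.integrable_comp_emb (MeasurableEquiv.measurableEmbedding _)).2 hi).integral_prod_right
    _ = c := by simp

/-- bounded continuous functions are integrable -/
lemma muU_integrable {m : ℕ} (g : (Fin m → ℝ) → ℝ) (hg : Continuous g) (B : ℝ)
    (hB : ∀ ξ, |g ξ| ≤ B) : Integrable g (muU m) :=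
  Integrable.of_bound hg.aestronglyMeasurable B (Filter.Eventually.of_forall hB)

lemma muU_ae {m : ℕ} (ℓ : Fin m) : ∀ᵐ ξ ∂(muU m), |ξ ℓ| ≤ 1/2 := by
  have h : ∀ᵐ x ∂nuU, |x| ≤ 1/2 := by
    refine (ae_restrict_iff' measurableSet_Ioc).2 (Filter.Eventually.of_forall ?_)
    rintro x ⟨h1, h2⟩
    rw [abs_le]; constructor <;> linarith
  exact (measurePreserving_eval (fun _ : Fin m => nuU) ℓ).quasiMeasurePreserving.ae h

lemma muU_integrable_mul {m : ℕ} (ℓ k : Fin m) : Integrable (fun ξ => ξ ℓ * ξ k) (muU m) := by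
  refine Integrable.of_bound (by fun_prop) (1/4) ?_
  filter_upwards [muU_ae ℓ, muU_ae k] with ξ h1 h2
  rw [Real.norm_eq_abs, abs_mul]
  nlinarith [abs_nonneg (ξ ℓ), abs_nonneg (ξ k)]

lemma muU_cross {m : ℕ} (ℓ k : Fin m) (h : ℓ ≠ k) (a : ℝ) :
    ∫ ξ, a * (ξ ℓ * ξ k) ∂(muU m) ≤ 0 := by
  refine muU_int_deriv_le ℓ (fun ξ => a * (ξ ℓ ^ 2 / 2 * ξ k)) _ (by fun_prop)
    ((muU_integrable_mul ℓ k).const_mul a) ?_ 0 ?_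
  · intro ξ
    simp only [Function.update_self, Function.update_of_ne h.symm]
    have := ((((hasDerivAt_id (ξ ℓ)).pow 2).div_const 2).mul_const (ξ k)).const_mul a
    exact this.congr_deriv (by simp)
  · intro ξ
    simp only [Function.update_self, Function.update_of_ne h.symm]
    norm_num

lemma muU_sq {m : ℕ} (s : Fin m → ℝ) (hs : ∀ ℓ, s ℓ ^ 2 = 1) :
    Integrable (fun ξ => (∑ ℓ, s ℓ * ξ ℓ) ^ 2) (muU m) ∧
    ∫ ξ, (∑ ℓ, s ℓ * ξ ℓ) ^ 2 ∂(muU m) ≤ m / 4 := by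
  have e : (fun ξ : Fin m → ℝ => (∑ ℓ, s ℓ * ξ ℓ) ^ 2)
      = fun ξ => ∑ ℓ, ∑ k, (s ℓ * s k) * (ξ ℓ * ξ k) := by
    funext ξ
    rw [sq, Finset.sum_mul_sum]
    refine Finset.sum_congr rfl fun _ _ => Finset.sum_congr rfl fun _ _ => by ring
  rw [e]
  have hi : ∀ ℓ k : Fin m, Integrable (fun ξ : Fin m → ℝ => (s ℓ * s k) * (ξ ℓ * ξ k)) (muU m) :=
    fun ℓ k => (muU_integrable_mul ℓ k).const_mul _
  refine ⟨integrable_finsetSum _ fun ℓ _ => integrable_finsetSum _ fun k _ => hi ℓ k, ?_⟩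
  rw [integral_finsetSum _ fun ℓ _ => integrable_finsetSum _ fun k _ => hi ℓ k]
  calc _ ≤ ∑ ℓ : Fin m, (1/4 : ℝ) := by
        refine Finset.sum_le_sum fun ℓ _ => ?_
        rw [integral_finsetSum _ fun k _ => hi ℓ k]
        calc _ ≤ ∑ k : Fin m, if ℓ = k then (1/4 : ℝ) else 0 := by
              refine Finset.sum_le_sum fun k _ => ?_
              split_ifs with h
              · subst h
                calc _ ≤ ∫ ξ, (1/4 : ℝ) ∂(muU m) := by
                      apply integral_mono_ae (hi ℓ ℓ) (integrable_const _)
                      filter_upwards [muU_ae ℓ] with ξ h1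
                      have := hs ℓ
                      have h2 := abs_le.1 h1
                      have h3 : s ℓ * s ℓ = 1 := by rw [← sq]; exact this
                      rw [h3]; nlinarith
                  _ = 1/4 := by simp
              · exact muU_cross ℓ k h _
          _ = 1/4 := by simp
    _ = m / 4 := by simp; ring

/-- sign of a Boolean -/
def sgB (b : Bool) : ℝ := if b then 1 else -1

/-- probability weight of a single coordinate -/
def aW (θ : ℝ) (b : Bool) : ℝ := 1/2 + sgB b * (Real.arctan θ / Real.pi)

/-- derivative kernel -/
def dW (θ : ℝ) : ℝ := (1 + θ ^ 2)⁻¹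

lemma aW_nonneg (θ : ℝ) (b : Bool) : 0 ≤ aW θ b := by
  have h1 := Real.arctan_lt_pi_div_two θ
  have h2 := Real.neg_pi_div_two_lt_arctan θ
  have hp := Real.pi_pos
  have h3 : Real.arctan θ / Real.pi ≤ 1/2 := by rw [div_le_iff₀ hp]; linarith
  have h4 : -(1/2) ≤ Real.arctan θ / Real.pi := by rw [le_div_iff₀ hp]; linarith
  cases b <;> simp [aW, sgB] <;> linarith

lemma aW_sum (θ : ℝ) : ∑ b, aW θ b = 1 := by
  simp [aW, sgB]; ring

lemma aW_le (θ : ℝ) (b : Bool) : aW θ b ≤ 1 := by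
  rw [← aW_sum θ]
  exact Finset.single_le_sum (f := aW θ) (fun b _ => aW_nonneg θ b) (Finset.mem_univ b)

lemma aW_cont (b : Bool) : Continuous fun θ => aW θ b := by
  unfold aW
  have := Real.continuous_arctan
  fun_prop

lemma aW_deriv (θ : ℝ) (b : Bool) : HasDerivAt (fun θ => aW θ b) (sgB b / Real.pi * dW θ) θ := by
  have := (((Real.hasDerivAt_arctan' θ).div_const Real.pi).const_mul (sgB b)).const_add (1/2)
  exact this.congr_deriv (by unfold dW; ring)

lemma dW_nonneg (θ : ℝ) : 0 ≤ dW θ := by unfold dW; positivity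

lemma dW_le (θ : ℝ) : dW θ ≤ 1 := by
  unfold dW; apply inv_le_one_of_one_le₀; nlinarith [sq_nonneg θ]

lemma dW_ge (θ : ℝ) : 1 - θ ^ 2 ≤ dW θ := by
  unfold dW
  rw [← one_div, le_div_iff₀ (by positivity)]
  nlinarith [sq_nonneg θ, sq_nonneg (θ^2)]

lemma dW_cont : Continuous dW := by
  unfold dW
  apply Continuous.inv₀ (by fun_prop)
  intro x; positivity

/-- edge weight for fixed `θ` -/
def gW {n : ℕ} (θ : Fin n → ℝ) (σ : Fin n → Bool) (k : Fin n) : ℝ :=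
  dW (θ k) * ∏ j ∈ Finset.univ.erase k, aW (θ j) (σ j)

/-- vertex weight for fixed `θ` -/
def pW {n : ℕ} (θ : Fin n → ℝ) (σ : Fin n → Bool) : ℝ := ∏ j, aW (θ j) (σ j)

lemma pW_nonneg {n : ℕ} (θ : Fin n → ℝ) (σ : Fin n → Bool) : 0 ≤ pW θ σ :=
  Finset.prod_nonneg fun _ _ => aW_nonneg _ _

lemma pW_sum {n : ℕ} (θ : Fin n → ℝ) : ∑ σ, pW θ σ = 1 := by
  have := Finset.prod_univ_sum (fun _ : Fin n => (Finset.univ : Finset Bool))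
    (fun j b => aW (θ j) b)
  rw [Fintype.piFinset_univ] at this
  unfold pW
  rw [← this]
  simp only [aW_sum, Finset.prod_const_one]

lemma gW_nonneg {n : ℕ} (θ : Fin n → ℝ) (σ : Fin n → Bool) (k : Fin n) : 0 ≤ gW θ σ k :=
  mul_nonneg (dW_nonneg _) (Finset.prod_nonneg fun _ _ => aW_nonneg _ _)

lemma gW_le {n : ℕ} (θ : Fin n → ℝ) (σ : Fin n → Bool) (k : Fin n) : gW θ σ k ≤ 1 :=
  mul_le_one₀ (dW_le _) (Finset.prod_nonneg fun _ _ => aW_nonneg _ _)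
    (Finset.prod_le_one (fun _ _ => aW_nonneg _ _) fun _ _ => aW_le _ _)

lemma gW_sum {n : ℕ} (θ : Fin n → ℝ) (k : Fin n) : ∑ σ, gW θ σ k = 2 * dW (θ k) := by
  have := Finset.prod_univ_sum (fun _ : Fin n => (Finset.univ : Finset Bool))
    (fun j b => if j = k then dW (θ k) else aW (θ j) b)
  rw [Fintype.piFinset_univ] at this
  have h2 : ∀ σ : Fin n → Bool, gW θ σ k = ∏ j, if j = k then dW (θ k) else aW (θ j) (σ j) := by
    intro σ
    rw [← Finset.mul_prod_erase Finset.univ _ (Finset.mem_univ k), gW]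
    simp only [if_true]
    congr 1
    refine Finset.prod_congr rfl fun j hj => ?_
    rw [if_neg (Finset.ne_of_mem_erase hj)]
  simp_rw [h2]
  rw [← this, ← Finset.mul_prod_erase Finset.univ _ (Finset.mem_univ k)]
  rw [Finset.prod_eq_one]
  · simp
  · intro j hj
    simp only [if_neg (Finset.ne_of_mem_erase hj)]
    exact aW_sum _

/-- flip a Boolean coordinate -/
def flB {n : ℕ} (σ : Fin n → Bool) (k : Fin n) : Fin n → Bool := Function.update σ k (!σ k)

lemma flB_flB {n : ℕ} (σ : Fin n → Bool) (k : Fin n) : flB (flB σ k) k = σ := by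
  simp [flB]

lemma gW_flB {n : ℕ} (θ : Fin n → ℝ) (σ : Fin n → Bool) (k : Fin n) :
    gW θ (flB σ k) k = gW θ σ k := by
  unfold gW
  congr 1
  refine Finset.prod_congr rfl fun j hj => ?_
  rw [flB, Function.update_of_ne (Finset.ne_of_mem_erase hj)]

/-- the tilt parameters -/
def thW {n m : ℕ} (s : Fin m → Fin n → ℝ) (ξ : Fin m → ℝ) (i : Fin n) : ℝ :=
  (√m)⁻¹ * ∑ ℓ, s ℓ i * ξ ℓ

/-- averaged edge weights -/
def wW {n m : ℕ} (s : Fin m → Fin n → ℝ) (σ : Fin n → Bool) (k : Fin n) : ℝ :=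
  ∫ ξ, gW (thW s ξ) σ k ∂(muU m)

lemma thW_cont {n m : ℕ} (s : Fin m → Fin n → ℝ) (i : Fin n) : Continuous fun ξ => thW s ξ i := by
  unfold thW; fun_prop

lemma gW_cont {n m : ℕ} (s : Fin m → Fin n → ℝ) (σ : Fin n → Bool) (k : Fin n) :
    Continuous fun ξ => gW (thW s ξ) σ k := by
  unfold gW
  refine (dW_cont.comp (thW_cont s k)).mul (continuous_finsetProd _ fun j _ => ?_)
  exact (aW_cont (σ j)).comp (thW_cont s j)

lemma gW_int {n m : ℕ} (s : Fin m → Fin n → ℝ) (σ : Fin n → Bool) (k : Fin n) :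
    Integrable (fun ξ => gW (thW s ξ) σ k) (muU m) :=
  muU_integrable _ (gW_cont s σ k) 1 fun ξ => by
    rw [abs_of_nonneg (gW_nonneg _ _ _)]; exact gW_le _ _ _

lemma thW_deriv {n m : ℕ} (s : Fin m → Fin n → ℝ) (ℓ : Fin m) (ξ : Fin m → ℝ) (i : Fin n) (r : ℝ) :
    HasDerivAt (fun r => thW s (Function.update ξ ℓ r) i) ((√m)⁻¹ * s ℓ i) r := by
  have e : (fun r => thW s (Function.update ξ ℓ r) i) = fun r =>
      (√m)⁻¹ * (s ℓ i * r + ∑ k ∈ Finset.univ.erase ℓ, s k i * ξ k) := by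
    funext r
    unfold thW
    rw [← Finset.add_sum_erase Finset.univ _ (Finset.mem_univ ℓ)]
    simp only [Function.update_self]
    congr 2
    refine Finset.sum_congr rfl fun j hj => ?_
    rw [Function.update_of_ne (Finset.ne_of_mem_erase hj)]
  rw [e]
  have := (((hasDerivAt_id r).const_mul (s ℓ i)).add_const
    (∑ k ∈ Finset.univ.erase ℓ, s k i * ξ k)).const_mul (√m)⁻¹
  simpa using this

lemma pW_deriv {n m : ℕ} (s : Fin m → Fin n → ℝ) (ℓ : Fin m) (ξ : Fin m → ℝ) (σ : Fin n → Bool) :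
    HasDerivAt (fun r => pW (thW s (Function.update ξ ℓ r)) σ)
      (∑ i, (√m)⁻¹ / Real.pi * (s ℓ i * sgB (σ i) * gW (thW s ξ) σ i)) (ξ ℓ) := by
  unfold pW
  have h := HasDerivAt.fun_finsetProd (u := Finset.univ) (x := ξ ℓ)
    (f := fun j r => aW (thW s (Function.update ξ ℓ r) j) (σ j))
    (f' := fun j => sgB (σ j) / Real.pi * dW (thW s ξ j) * ((√m)⁻¹ * s ℓ j)) (by
      intro j _
      have h1 := aW_deriv (thW s ξ j) (σ j)
      have h2 := thW_deriv s ℓ ξ j (ξ ℓ)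
      have h1' : HasDerivAt (fun θ => aW θ (σ j)) (sgB (σ j) / Real.pi * dW (thW s ξ j))
          (thW s (Function.update ξ ℓ (ξ ℓ)) j) := by
        rw [Function.update_eq_self]; exact h1
      exact HasDerivAt.comp (h₂ := fun θ => aW θ (σ j))
        (h := fun r => thW s (Function.update ξ ℓ r) j) (ξ ℓ) h1' h2)
  refine h.congr_deriv (Eq.symm ?_)
  refine Finset.sum_congr rfl fun i _ => ?_
  rw [Function.update_eq_self, gW, smul_eq_mul]
  ring

lemma wW_nonneg {n m : ℕ} (s : Fin m → Fin n → ℝ) (σ : Fin n → Bool) (k : Fin n) : 0 ≤ wW s σ k :=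
  integral_nonneg fun _ => gW_nonneg _ _ _

lemma wW_flB {n m : ℕ} (s : Fin m → Fin n → ℝ) (σ : Fin n → Bool) (k : Fin n) :
    wW s (flB σ k) k = wW s σ k := by
  unfold wW; simp_rw [gW_flB]

lemma wW_total {n m : ℕ} (hm : 0 < m) (s : Fin m → Fin n → ℝ) (hs : ∀ ℓ i, s ℓ i ^ 2 = 1)  :
    (3/2 : ℝ) * n ≤ ∑ k, ∑ σ, wW s σ k := by
  have hk : ∀ k, (3/2 : ℝ) ≤ ∑ σ, wW s σ k := by
    intro k
    unfold wW
    rw [← integral_finsetSum _ fun σ _ => gW_int s σ k]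
    simp_rw [gW_sum]
    obtain ⟨h1, h2⟩ := muU_sq (fun ℓ => s ℓ k) (fun ℓ => hs ℓ k)
    have hd : Integrable (fun ξ => 2 * dW (thW s ξ k)) (muU m) := by
      refine (muU_integrable _ (dW_cont.comp (thW_cont s k)) 1 fun ξ => ?_).const_mul 2
      simp only [Function.comp]
      rw [abs_of_nonneg (dW_nonneg _)]; exact dW_le _
    have h3 : ∫ ξ, (2 - (2 / m) * (∑ ℓ, s ℓ k * ξ ℓ) ^ 2) ∂(muU m) ≤
        ∫ ξ, 2 * dW (thW s ξ k) ∂(muU m) := by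
      refine integral_mono ((integrable_const _).sub (h1.const_mul _)) hd fun ξ => ?_
      have := dW_ge (thW s ξ k)
      have e : thW s ξ k ^ 2 = 1 / m * (∑ ℓ, s ℓ k * ξ ℓ) ^ 2 := by
        unfold thW
        rw [mul_pow, inv_pow, Real.sq_sqrt (by positivity)]
        simp
      rw [e] at this
      have e2 : (2 / m : ℝ) = 2 * (1 / m) := by ring
      simp only [e2]
      linarith
    refine le_trans ?_ h3
    rw [integral_sub (integrable_const _) (h1.const_mul _), integral_const_mul]
    have hm' : (0 : ℝ) < m := by exact_mod_cast hm
    have : 2 / (m : ℝ) * ∫ ξ, (∑ ℓ, s ℓ k * ξ ℓ) ^ 2 ∂(muU m) ≤ 2 / m * (m / 4) := by gcongr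
    have e3 : 2 / (m : ℝ) * (m / 4) = 1/2 := by field_simp; norm_num
    simp
    linarith
  calc (3/2 : ℝ) * n = ∑ k : Fin n, (3/2 : ℝ) := by simp; ring
    _ ≤ _ := Finset.sum_le_sum fun k _ => hk k

lemma wW_flux {n m : ℕ} (hm : 0 < m) (s : Fin m → Fin n → ℝ) (ℓ : Fin m)
    (f : (Fin n → Bool) → ℝ) (h0 : ∀ σ, 0 ≤ f σ) (h1 : ∀ σ, f σ ≤ 1) :
    ∑ k, ∑ σ, f σ * (s ℓ k * sgB (σ k) * wW s σ k) ≤ Real.pi * √m := by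
  have hm' : (0 : ℝ) < √m := Real.sqrt_pos.2 (by exact_mod_cast hm)
  have hint : Integrable (fun ξ => ∑ σ, f σ *
      ∑ i, (√m)⁻¹ / Real.pi * (s ℓ i * sgB (σ i) * gW (thW s ξ) σ i)) (muU m) :=
    integrable_finsetSum _ fun σ _ => (integrable_finsetSum _ fun i _ =>
      ((gW_int s σ i).const_mul _).const_mul _).const_mul _
  have key := muU_int_deriv_le ℓ (fun ξ => ∑ σ, f σ * pW (thW s ξ) σ)
    (fun ξ => ∑ σ, f σ * ∑ i, (√m)⁻¹ / Real.pi * (s ℓ i * sgB (σ i) * gW (thW s ξ) σ i))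
    (by
      refine continuous_finsetSum _ fun σ _ => continuous_const.mul
        (continuous_finsetSum _ fun i _ => continuous_const.mul
          (continuous_const.mul (gW_cont s σ i)))) hint
    (fun ξ => HasDerivAt.fun_sum fun σ _ => (pW_deriv s ℓ ξ σ).const_mul (f σ)) 1
    (by
      intro ξ
      have a1 : ∑ σ, f σ * pW (thW s (Function.update ξ ℓ (1/2))) σ ≤ 1 := by
        refine le_trans ?_ (pW_sum (thW s (Function.update ξ ℓ (1/2)))).le
        exact Finset.sum_le_sum fun σ _ => mul_le_of_le_one_left (pW_nonneg _ _) (h1 σ)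
      have a2 : 0 ≤ ∑ σ, f σ * pW (thW s (Function.update ξ ℓ (-1/2))) σ :=
        Finset.sum_nonneg fun σ _ => mul_nonneg (h0 σ) (pW_nonneg _ _)
      linarith)
  have e : ∫ ξ, ∑ σ, f σ * ∑ i, (√m)⁻¹ / Real.pi * (s ℓ i * sgB (σ i) * gW (thW s ξ) σ i) ∂(muU m)
      = (√m)⁻¹ / Real.pi * ∑ k, ∑ σ, f σ * (s ℓ k * sgB (σ k) * wW s σ k) := by
    rw [integral_finsetSum _ fun σ _ => (integrable_finsetSum _ fun i _ =>
      ((gW_int s σ i).const_mul _).const_mul _).const_mul _]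
    rw [Finset.sum_comm, Finset.mul_sum]
    refine Finset.sum_congr rfl fun σ _ => ?_
    rw [integral_const_mul, integral_finsetSum _ fun i _ =>
      ((gW_int s σ i).const_mul _).const_mul _, Finset.mul_sum, Finset.mul_sum]
    refine Finset.sum_congr rfl fun i _ => ?_
    rw [integral_const_mul, integral_const_mul, wW]
    ring
  rw [e] at key
  have hp := Real.pi_pos
  have : (√m)⁻¹ / Real.pi = (Real.pi * √m)⁻¹ := by rw [mul_inv]; ring
  rw [this, inv_mul_le_iff₀ (by positivity)] at key
  linarith

lemma sgB_flB {n : ℕ} (σ : Fin n → Bool) (k : Fin n) :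
    flipCoord (fun i => sgB (σ i)) k = fun i => sgB (flB σ k i) := by
  funext i
  by_cases h : i = k
  · subst h
    cases hb : σ i <;> simp [flipCoord, flB, sgB, hb]
  · simp [flipCoord, flB, h]

lemma sum_flB {n : ℕ} (v : Fin n → ℝ) (σ : Fin n → Bool) (k : Fin n) :
    ∑ i, v i * sgB (flB σ k i) = ∑ i, v i * sgB (σ i) - 2 * (v k * sgB (σ k)) := by
  rw [← Finset.add_sum_erase Finset.univ _ (Finset.mem_univ k),
    ← Finset.add_sum_erase Finset.univ (fun i => v i * sgB (σ i)) (Finset.mem_univ k)]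
  have h1 : sgB (flB σ k k) = - sgB (σ k) := by
    cases hb : σ k <;> simp [flB, sgB, hb]
  have h2 : ∑ i ∈ Finset.univ.erase k, v i * sgB (flB σ k i)
      = ∑ i ∈ Finset.univ.erase k, v i * sgB (σ i) := by
    refine Finset.sum_congr rfl fun j hj => ?_
    rw [flB, Function.update_of_ne (Finset.ne_of_mem_erase hj)]
  rw [h1, h2]; ring

lemma edge_opposite {n : ℕ} (v : Fin n → ℝ) (t : ℝ) (u : Fin n → ℝ) (k : Fin n)
    (h : edgeCrosses v t u k) :
    (∑ i, v i * u i < t ∧ t < ∑ i, v i * flipCoord u k i) ∨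
    (t < ∑ i, v i * u i ∧ ∑ i, v i * flipCoord u k i < t) := by
  obtain ⟨⟨y, ⟨a, b, ha, hb, hab, rfl⟩, hy⟩, h1, h2⟩ := h
  have e : ∑ i, v i * (a • u + b • flipCoord u k) i
      = a * ∑ i, v i * u i + b * ∑ i, v i * flipCoord u k i := by
    rw [Finset.mul_sum, Finset.mul_sum, ← Finset.sum_add_distrib]
    refine Finset.sum_congr rfl fun i _ => ?_
    simp only [Pi.add_apply, Pi.smul_apply, smul_eq_mul]; ring
  rw [e] at hy
  generalize ∑ i, v i * u i = A at *
  generalize ∑ i, v i * flipCoord u k i = B at *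
  have ht : t = a * t + b * t := by rw [← add_mul, hab, one_mul]
  rcases lt_or_gt_of_ne h1 with h1 | h1 <;> rcases lt_or_gt_of_ne h2 with h2 | h2
  · exfalso
    rcases ha.lt_or_eq with ha' | ha'
    · nlinarith [mul_pos ha' (sub_pos.2 h1), mul_nonneg hb (sub_pos.2 h2).le]
    · nlinarith [mul_nonneg ha (sub_pos.2 h1).le, mul_pos (show 0 < b by linarith) (sub_pos.2 h2)]
  · left; exact ⟨h1, h2⟩
  · right; exact ⟨h1, h2⟩
  · exfalso
    rcases ha.lt_or_eq with ha' | ha'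
    · nlinarith [mul_pos ha' (sub_pos.2 h1), mul_nonneg hb (sub_pos.2 h2).le]
    · nlinarith [mul_nonneg ha (sub_pos.2 h1).le, mul_pos (show 0 < b by linarith) (sub_pos.2 h2)]

/-- sign of a real number with the convention that zero is positive -/
def sgR (x : ℝ) : ℝ := if 0 ≤ x then 1 else -1

/-- half-space indicator -/
def fH {n : ℕ} (v : Fin n → ℝ) (t : ℝ) (σ : Fin n → Bool) : ℝ :=
  open Classical in if t < ∑ i, v i * sgB (σ i) then 1 else 0

open Classical in
lemma cross_le {n : ℕ} (v : Fin n → ℝ) (t : ℝ) (σ : Fin n → Bool) (k : Fin n) :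
    (if edgeCrosses v t (fun i => sgB (σ i)) k then (1 : ℝ) else 0) ≤
      sgR (v k) * sgB (σ k) * (fH v t σ - fH v t (flB σ k)) := by
  have hs := sum_flB v σ k
  have ho := edge_opposite v t (fun i => sgB (σ i)) k
  rw [sgB_flB] at ho
  unfold fH sgR
  split_ifs with h h1 h2 h3 <;> cases hb : σ k <;> simp [hb, sgB] at * <;> grind

open Classical in
lemma cross_sum {n m : ℕ} (hm : 0 < m) (v : Fin m → Fin n → ℝ) (t : ℝ) (ℓ : Fin m) :
    ∑ k, ∑ σ, wW (fun ℓ i => sgR (v ℓ i)) σ k *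
      (if edgeCrosses (v ℓ) t (fun i => sgB (σ i)) k then (1 : ℝ) else 0) ≤
      2 * (Real.pi * √m) := by
  set s : Fin m → Fin n → ℝ := fun ℓ i => sgR (v ℓ i) with hsdef
  have hf := wW_flux hm s ℓ (fH (v ℓ) t)
    (fun σ => by unfold fH; split_ifs <;> norm_num) (fun σ => by unfold fH; split_ifs <;> norm_num)
  refine le_trans ?_ (mul_le_mul_of_nonneg_left hf (by norm_num : (0:ℝ) ≤ 2))
  rw [Finset.mul_sum]
  refine Finset.sum_le_sum fun k _ => ?_
  have hinv : ∑ σ, fH (v ℓ) t (flB σ k) * (s ℓ k * sgB (σ k) * wW s σ k)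
      = ∑ σ, -(fH (v ℓ) t σ * (s ℓ k * sgB (σ k) * wW s σ k)) := by
    refine Fintype.sum_equiv (Function.Involutive.toPerm (fun σ => flB σ k)
      (fun σ => flB_flB σ k)) _ _ fun σ => ?_
    change _ = -(fH (v ℓ) t (flB σ k) * (s ℓ k * sgB (flB σ k k) * wW s (flB σ k) k))
    have h1 : sgB (flB σ k k) = - sgB (σ k) := by
      cases hb : σ k <;> simp [flB, sgB, hb]
    rw [h1, wW_flB]; ring
  rw [Finset.sum_neg_distrib] at hinv
  calc _ ≤ ∑ σ, (fH (v ℓ) t σ * (s ℓ k * sgB (σ k) * wW s σ k)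
        - fH (v ℓ) t (flB σ k) * (s ℓ k * sgB (σ k) * wW s σ k)) := by
        refine Finset.sum_le_sum fun σ _ => ?_
        have := mul_le_mul_of_nonneg_left (cross_le (v ℓ) t σ k) (wW_nonneg s σ k)
        refine this.trans (le_of_eq ?_)
        simp only [hsdef]; ring
    _ = _ := by rw [Finset.sum_sub_distrib, hinv]; ring

end CubeProof

/-- Proposition 2.6, existential form: there is an absolute constant
`C > 0` such that for all `n, m ≥ 2` and hyperplanes `H_ℓ = {x | ⟨v_ℓ, x⟩ = t_ℓ}`
(`‖v_ℓ‖₂ = 1`, `1 ≤ ℓ ≤ m`), there is a probability distribution on edges `(u, k)` of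
the `n`-cube such that each `H_ℓ` is crossed with probability at most
`C·√m·(log n)²/n`. -/
theorem stmt_1 :
    ∃ C : ℝ, 0 < C ∧
      ∀ (n m : ℕ), 2 ≤ n → 2 ≤ m →
        ∀ (v : Fin m → Fin n → ℝ), (∀ ℓ, ∑ i, v ℓ i ^ 2 = 1) →
          ∀ (t : Fin m → ℝ),
            ∃ μ : Measure ((Fin n → ℝ) × Fin n), IsProbabilityMeasure μ ∧
              μ {e | isCubeVertex e.1} = 1 ∧
              ∀ ℓ, μ {e | edgeCrosses (v ℓ) (t ℓ) e.1 e.2} ≤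
                ENNReal.ofReal (C * Real.sqrt m * Real.log n ^ 2 / n) := by
  classical
  have hl2 : 0 < Real.log 2 := Real.log_pos (by norm_num)
  refine ⟨5 / Real.log 2 ^ 2, by positivity, ?_⟩
  intro n m hn hm v _ t
  set s : Fin m → Fin n → ℝ := fun ℓ i => sgR (v ℓ i) with hsdef
  have hs : ∀ ℓ i, s ℓ i ^ 2 = 1 := by
    intro ℓ i
    simp only [hsdef, sgR]
    split_ifs <;> norm_num
  have htot := wW_total (by omega) s hs
  rw [← Finset.sum_product' (f := fun k σ => wW s σ k)] at htot
  set T : ℝ := ∑ x ∈ (Finset.univ : Finset (Fin n)) ×ˢ (Finset.univ : Finset (Fin n → Bool)),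
    wW s x.2 x.1 with hT
  have hn0 : (0 : ℝ) < n := by positivity
  have hTpos : 0 < T := by linarith
  have hq : ∀ x : Fin n × (Fin n → Bool), 0 ≤ wW s x.2 x.1 / T :=
    fun x => div_nonneg (wW_nonneg _ _ _) hTpos.le
  have hsum1 : ∑ x : Fin n × (Fin n → Bool), wW s x.2 x.1 / T = 1 := by
    rw [← Finset.sum_div, ← Finset.univ_product_univ, ← hT]
    exact div_self hTpos.ne'
  let μ : Measure ((Fin n → ℝ) × Fin n) := ∑ x : Fin n × (Fin n → Bool),
    ENNReal.ofReal (wW s x.2 x.1 / T) • Measure.dirac ((fun i => sgB (x.2 i)), x.1)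
  have hμ : ∀ A : Set ((Fin n → ℝ) × Fin n), μ A = ENNReal.ofReal (∑ x : Fin n × (Fin n → Bool),
      wW s x.2 x.1 / T * (if ((fun i => sgB (x.2 i)), x.1) ∈ A then 1 else 0)) := by
    intro A
    rw [ENNReal.ofReal_sum_of_nonneg]
    · simp only [μ, Measure.coe_finsetSum, Finset.sum_apply, Measure.smul_apply,
        Measure.dirac_apply, smul_eq_mul]
      refine Finset.sum_congr rfl fun x _ => ?_
      by_cases h : ((fun i => sgB (x.2 i)), x.1) ∈ A <;> simp [h]
    · intro x _
      exact mul_nonneg (hq x) (by split_ifs <;> norm_num)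
  refine ⟨μ, ⟨?_⟩, ?_, ?_⟩
  · rw [hμ]; simp [hsum1]
  · rw [hμ]
    have : ∀ x : Fin n × (Fin n → Bool), (((fun i => sgB (x.2 i)), x.1) :
        (Fin n → ℝ) × Fin n) ∈ {e : (Fin n → ℝ) × Fin n | isCubeVertex e.1} := by
      intro x i
      cases hb : x.2 i <;> simp [sgB, hb]
    simp only [this, if_true, mul_one, hsum1, ENNReal.ofReal_one]
  · intro ℓ
    rw [hμ]
    apply ENNReal.ofReal_le_ofReal
    have hc := cross_sum (by omega) v (t ℓ) ℓ
    rw [← hsdef, ← Finset.sum_product', Finset.univ_product_univ] at hc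
    simp only [Set.mem_ofPred_eq]
    simp_rw [div_mul_eq_mul_div]
    rw [← Finset.sum_div]
    have hlog : Real.log 2 ≤ Real.log n := Real.log_le_log (by norm_num) (by exact_mod_cast hn)
    have hπ : Real.pi ≤ 15 / 4 := by linarith [Real.pi_lt_d2]
    have hsq : 0 ≤ √(m : ℝ) := Real.sqrt_nonneg _
    calc _ ≤ 2 * (Real.pi * √m) / T := by gcongr
      _ ≤ 2 * (15 / 4 * √m) / ((3/2) * n) := by gcongr
      _ = 5 * √m * 1 / n := by field_simp; norm_num
      _ ≤ 5 * √m * (Real.log n ^ 2 / Real.log 2 ^ 2) / n := by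
        gcongr
        rw [le_div_iff₀ (by positivity), one_mul]
        gcongr
      _ = _ := by ring
end
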